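/- There is no 8×8 real matrix B satisfying all of: Bᵀη = −ηB (B ∈ so(4,4)); [B, J_k] ∈ span_ℝ{J₁, J₂, J₃} for k = 1, 2, 3 (B normalizes V = span{J₁, J₂, J₃}); [B, J₁] = 0; and B·(3e₁ + 4e₂ + 5e₅) = J₁·(3e₁ + 4e₂ + 5e₅). (This is the algebraic obstruction showing that the 11-dimensional pseudo H-type group N_{0,3} is not a geodesic orbit manifold.) -/

import Mathlib

open Matrix

noncomputable section

/-- `η = diag(1,1,1,1,−1,−1,−1,−1)`. -/
def η : Matrix (Fin 8) (Fin 8) ℝ :=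
  Matrix.diagonal ![1, 1, 1, 1, -1, -1, -1, -1]

/-- The Clifford map `J_{Z₁}` of the pseudo H-type Lie algebra `n_{0,3}`. -/
def J1 : Matrix (Fin 8) (Fin 8) ℝ :=
  !![0,0,0,0,1,0,0,0;
     0,0,0,0,0,1,0,0;
     0,0,0,0,0,0,1,0;
     0,0,0,0,0,0,0,1;
     1,0,0,0,0,0,0,0;
     0,1,0,0,0,0,0,0;
     0,0,1,0,0,0,0,0;
     0,0,0,1,0,0,0,0]

/-- The Clifford map `J_{Z₂}` of the pseudo H-type Lie algebra `n_{0,3}`. -/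
def J2 : Matrix (Fin 8) (Fin 8) ℝ :=
  !![0,0,0,0,0,1,0,0;
     0,0,0,0,-1,0,0,0;
     0,0,0,0,0,0,0,-1;
     0,0,0,0,0,0,1,0;
     0,-1,0,0,0,0,0,0;
     1,0,0,0,0,0,0,0;
     0,0,0,1,0,0,0,0;
     0,0,-1,0,0,0,0,0]

/-- The Clifford map `J_{Z₃}` of the pseudo H-type Lie algebra `n_{0,3}`. -/
def J3 : Matrix (Fin 8) (Fin 8) ℝ :=
  !![0,0,0,0,0,0,1,0;
     0,0,0,0,0,0,0,1;
     0,0,0,0,-1,0,0,0;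
     0,0,0,0,0,-1,0,0;
     0,0,-1,0,0,0,0,0;
     0,0,0,-1,0,0,0,0;
     1,0,0,0,0,0,0,0;
     0,1,0,0,0,0,0,0]

/-- There is no `B ∈ so(4,4)` normalizing `V = span{J₁,J₂,J₃}` with `[B,J₁] = 0`
and `B·(3e₁+4e₂+5e₅) = J₁·(3e₁+4e₂+5e₅)`: the obstruction showing that `N_{0,3}`
is not geodesic orbit. -/
theorem statement18 :
    ¬ ∃ B : Matrix (Fin 8) (Fin 8) ℝ,
      B.transpose * η = -(η * B) ∧
      (B * J1 - J1 * B) ∈ Submodule.span ℝ {J1, J2, J3} ∧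
      (B * J2 - J2 * B) ∈ Submodule.span ℝ {J1, J2, J3} ∧
      (B * J3 - J3 * B) ∈ Submodule.span ℝ {J1, J2, J3} ∧
      B * J1 - J1 * B = 0 ∧
      B.mulVec ![3, 4, 0, 0, 5, 0, 0, 0] = J1.mulVec ![3, 4, 0, 0, 5, 0, 0, 0] := by
  rintro ⟨B, h, -, n2, -, n1, v⟩
  obtain ⟨a, b, c, n2⟩ := Submodule.mem_span_triple.1 n2
  have hh := fun i j => congrFun (congrFun h i) j
  have h05 := hh 0 5
  have h45 := hh 4 5
  have h01 := hh 0 1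
  have h11 := hh 1 1
  have h14 := hh 1 4
  have h00 := hh 0 0
  have m := congrFun (congrFun n2 0) 1
  have p5 := congrFun (congrFun n1 0) 5
  have p1 := congrFun (congrFun n1 0) 1
  have v5 := congrFun v 5
  have v1 := congrFun v 1
  have v0 := congrFun v 0
  clear hh h n2 n1 v
  simp [η, Matrix.mul_apply, Matrix.diagonal_apply, Fin.sum_univ_eight] at h05 h45 h01 h11 h14 h00
  simp [J1, J2, J3, Matrix.mul_apply, Matrix.vecMul, dotProduct, Fin.sum_univ_eight] at m p5 p1
  simp [J1, Matrix.mulVec, dotProduct, Fin.sum_univ_eight] at v5 v1 v0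
  linarith

end
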